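/- Let p > 0, d ≥ 1, let k₀ ≥ 3 be an integer, and let M ≥ 2 be a real number with M·p ≥ 2^d and log log k₀ ≤ M. Let S = {1 + (ℓ−1)·M·log(ℓe) : 1 ≤ ℓ ≤ k₀} and let a_1,…,a_k (k = k₀^d) enumerate S^d. Define the probability measure G on S^d by G{a_i} = C·(⟨a_i, 𝟏⟩ − d + 1)^{−(p+d)}, where 𝟏 = (1,…,1) ∈ ℝ^d and C = 1/Σ_{i=1}^k (⟨a_i, 𝟏⟩ − d + 1)^{−(p+d)} is the normalizing constant. Then 1/2 < C < 1 and ∫ ‖u‖^p dG(u) ≤ 6·d^p, i.e., G belongs to the class G₂(p, 6^{1/p}·d) of probability measures with p-th moment bounded by 6^{1/p}·d. -/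

import Mathlib

open Real

/-- The point of `S = {1 + (ℓ-1) M log(ℓ e) : 1 ≤ ℓ ≤ k₀}` indexed (0-based) by `ℓ : Fin k₀`. -/
noncomputable def latticePoint (M : ℝ) (k₀ : ℕ) (ℓ : Fin k₀) : ℝ :=
  1 + (ℓ : ℕ) * M * Real.log (((ℓ : ℕ) + 1) * Real.exp 1)

/-- The support point `a(ℓ) ∈ S^d` indexed by `ℓ : Fin d → Fin k₀`. -/
noncomputable def latticeVec (d : ℕ) (M : ℝ) (k₀ : ℕ) (ℓ : Fin d → Fin k₀) :
    Fin d → ℝ :=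
  fun i => latticePoint M k₀ (ℓ i)

/-- The unnormalized weight `(⟨a(ℓ), 𝟏⟩ - d + 1)^{-(p+d)}`. -/
noncomputable def rawWeight (d : ℕ) (p M : ℝ) (k₀ : ℕ) (ℓ : Fin d → Fin k₀) : ℝ :=
  ((∑ i, latticeVec d M k₀ ℓ i) - d + 1) ^ (-(p + d))

/-- The normalizing constant `C_{n,d,p}`. -/
noncomputable def normConst (d : ℕ) (p M : ℝ) (k₀ : ℕ) : ℝ :=
  (∑ ℓ : Fin d → Fin k₀, rawWeight d p M k₀ ℓ)⁻¹

/-- AM-GM in the form needed here. -/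
theorem aux_amgm (d : ℕ) (hd : 1 ≤ d) (y : Fin d → ℝ) (hy : ∀ i, 0 ≤ y i) (r : ℝ) (hr : 0 ≤ r) :
    (1 + ∑ i, y i) ^ (-r) ≤ ∏ i, (1 + d * y i) ^ (-(r / d)) := by
  have hd0 : (0 : ℝ) < d := by exact_mod_cast hd
  have hz : ∀ i, 0 < 1 + d * y i := fun i => by have := hy i; positivity
  have h := Real.geom_mean_le_arith_mean_weighted Finset.univ (fun _ : Fin d => (1 / d : ℝ))
    (fun i => 1 + d * y i) (fun i _ => by positivity)
    (by simp [hd0.ne']) (fun i _ => (hz i).le)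
  have e : ∑ i, (1 / d : ℝ) * (1 + d * y i) = 1 + ∑ i, y i := by
    rw [← Finset.mul_sum, Finset.sum_add_distrib, ← Finset.mul_sum]
    simp
    field_simp
  rw [e] at h
  have hpos : 0 < ∏ i, (1 + d * y i) ^ (1 / d : ℝ) :=
    Finset.prod_pos fun i _ => Real.rpow_pos_of_pos (hz i) _
  refine (Real.rpow_le_rpow_of_nonpos hpos h (by linarith)).trans (le_of_eq ?_)
  rw [← Real.finsetProd_rpow _ _ (fun i _ => (Real.rpow_pos_of_pos (hz i) _).le)]
  refine Finset.prod_congr rfl fun i _ => ?_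
  rw [← Real.rpow_mul (hz i).le]
  congr 1
  ring

theorem aux_step (a b q : ℝ) (ha : 0 < a) (hb : 0 < b) (hq : 0 < q) :
    q * (b - a) * b ^ (-(1 + q)) ≤ a ^ (-q) - b ^ (-q) := by
  have h1 : 1 + q * (1 - a / b) ≤ (a / b) ^ (-q) := by
    rw [Real.rpow_def_of_pos (by positivity)]
    have := Real.add_one_le_exp (Real.log (a / b) * -q)
    have h2 := Real.log_le_sub_one_of_pos (show 0 < a / b by positivity)
    nlinarith
  have hbq : 0 < b ^ (-q) := Real.rpow_pos_of_pos hb _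
  have e1 : b ^ (-(1 + q)) = b ^ (-q) * b⁻¹ := by
    rw [← Real.rpow_neg_one b, ← Real.rpow_add hb]; congr 1; ring
  have e2 : a ^ (-q) = (a / b) ^ (-q) * b ^ (-q) := by
    rw [← Real.mul_rpow (by positivity) hb.le]; congr 1; field_simp
  rw [e1, e2]
  have h3 := mul_le_mul_of_nonneg_right h1 hbq.le
  have e3 : q * (b - a) * (b ^ (-q) * b⁻¹) = q * (1 - a / b) * b ^ (-q) := by
    field_simp
  rw [e3]; linarith

theorem aux_sum1 (h q : ℝ) (hh : 0 < h) (hq : 0 < q) (n : ℕ) :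
    q * h * ∑ l ∈ Finset.range n, (1 + h * ((l : ℝ) + 1)) ^ (-(1 + q)) ≤
      1 - (1 + h * n) ^ (-q) := by
  induction n with
  | zero => simp
  | succ n ih =>
    rw [Finset.sum_range_succ, mul_add]
    have := aux_step (1 + h * n) (1 + h * ((n : ℝ) + 1)) q (by positivity) (by positivity) hq
    have e : (1 + h * ((n : ℝ) + 1)) - (1 + h * n) = h := by ring
    rw [e] at this
    push_cast
    linarith

theorem aux_sum2 (n : ℕ) :
    ∑ l ∈ Finset.range n, (((l : ℝ) + 2) * (1 + Real.log ((l : ℝ) + 2)))⁻¹ ≤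
      Real.log (1 + Real.log ((n : ℝ) + 1)) := by
  induction n with
  | zero => simp
  | succ n ih =>
    rw [Finset.sum_range_succ]
    have e : (((n + 1 : ℕ) : ℝ) + 1) = (n : ℝ) + 2 := by push_cast; ring
    rw [e]
    have hn : (0 : ℝ) ≤ n := Nat.cast_nonneg n
    have hA : 0 ≤ Real.log ((n : ℝ) + 1) := Real.log_nonneg (by linarith)
    have hB : 0 ≤ Real.log ((n : ℝ) + 2) := Real.log_nonneg (by linarith)
    have h1 := Real.log_le_sub_one_of_pos
      (show 0 < (1 + Real.log ((n : ℝ) + 1)) / (1 + Real.log ((n : ℝ) + 2)) by positivity)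
    rw [Real.log_div (by positivity) (by positivity)] at h1
    have h2 := Real.log_le_sub_one_of_pos
      (show 0 < ((n : ℝ) + 1) / ((n : ℝ) + 2) by positivity)
    rw [Real.log_div (by positivity) (by positivity)] at h2
    have h3 : (((n : ℝ) + 2) * (1 + Real.log ((n : ℝ) + 2)))⁻¹ ≤
        1 - (1 + Real.log ((n : ℝ) + 1)) / (1 + Real.log ((n : ℝ) + 2)) := by
      have e1 : 1 - (1 + Real.log ((n : ℝ) + 1)) / (1 + Real.log ((n : ℝ) + 2)) =
        (Real.log ((n : ℝ) + 2) - Real.log ((n : ℝ) + 1)) / (1 + Real.log ((n : ℝ) + 2)) := by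
        field_simp; ring
      have e2 : ((n : ℝ) + 1) / ((n : ℝ) + 2) - 1 = - ((n : ℝ) + 2)⁻¹ := by
        field_simp; ring
      rw [e1, mul_inv, div_eq_mul_inv]
      apply mul_le_mul_of_nonneg_right _ (by positivity)
      linarith
    linarith

/-- The shifted coordinate. -/
noncomputable def yy (M : ℝ) (l : ℕ) : ℝ := l * M * (1 + Real.log ((l : ℝ) + 1))

theorem latticePoint_eq (M : ℝ) (k₀ : ℕ) (l : Fin k₀) :
    latticePoint M k₀ l = 1 + yy M l := by
  unfold latticePoint yy
  rw [Real.log_mul (by positivity) (by positivity), Real.log_exp]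
  ring

theorem yy_ge (M : ℝ) (hM : 2 ≤ M) (l : ℕ) : l * M ≤ yy M l := by
  unfold yy
  have : 0 ≤ Real.log ((l : ℝ) + 1) := Real.log_nonneg (by simp)
  have : 0 ≤ (l : ℝ) * M := by positivity
  nlinarith

theorem yy_nonneg (M : ℝ) (hM : 2 ≤ M) (l : ℕ) : 0 ≤ yy M l :=
  le_trans (by positivity) (yy_ge M hM l)

/-- Sum over the lattice of powers is bounded by a product. -/
theorem aux_lattice (d k₀ : ℕ) (hd : 1 ≤ d) (M r B : ℝ) (hM : 2 ≤ M) (hr : 0 ≤ r)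
    (hB : ∑ l ∈ Finset.range (k₀ - 1), (1 + d * yy M (l + 1)) ^ (-(r / d)) ≤ B / d)
    (hk : 3 ≤ k₀) :
    ∑ l : Fin d → Fin k₀, (1 + ∑ i, yy M (l i)) ^ (-r) ≤ Real.exp B := by
  have hd0 : (0 : ℝ) < d := by exact_mod_cast hd
  have hnn : ∀ l : ℕ, 0 ≤ (1 + d * yy M l) ^ (-(r / d)) := fun l =>
    Real.rpow_nonneg (by have := yy_nonneg M hM l; positivity) _
  calc ∑ l : Fin d → Fin k₀, (1 + ∑ i, yy M (l i)) ^ (-r)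
      ≤ ∑ l : Fin d → Fin k₀, ∏ i, (1 + d * yy M (l i)) ^ (-(r / d)) :=
        Finset.sum_le_sum fun l _ => aux_amgm d hd (fun i => yy M (l i))
          (fun i => yy_nonneg M hM _) r hr
    _ = (∑ a : Fin k₀, (1 + d * yy M a) ^ (-(r / d))) ^ d := by
        rw [Fintype.sum_pow (fun a : Fin k₀ => (1 + d * yy M a) ^ (-(r / d))) d]
    _ ≤ (Real.exp (B / d)) ^ d := by
        apply pow_le_pow_left₀ (Finset.sum_nonneg fun (a : Fin k₀) _ => hnn a)
        rw [Fin.sum_univ_eq_sum_range (fun a : ℕ => (1 + d * yy M a) ^ (-(r / d))) k₀]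
        obtain ⟨n, rfl⟩ : ∃ n, k₀ = n + 1 := ⟨k₀ - 1, by omega⟩
        rw [Finset.sum_range_succ']
        have e : (1 + d * yy M 0) ^ (-(r / d)) = 1 := by simp [yy]
        rw [e]
        exact (add_le_add_left hB 1).trans (Real.add_one_le_exp _)
    _ = Real.exp B := by
        rw [← Real.exp_nat_mul]; congr 1; field_simp

theorem rawWeight_eq (d k₀ : ℕ) (p M : ℝ) (l : Fin d → Fin k₀) :
    rawWeight d p M k₀ l = (1 + ∑ i, yy M (l i)) ^ (-(p + d)) := by
  unfold rawWeight latticeVec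
  simp only [latticePoint_eq, Finset.sum_add_distrib]
  congr 1
  simp
  ring

theorem aux_A (d k₀ : ℕ) (hd : 1 ≤ d) (hk₀ : 3 ≤ k₀) (p M : ℝ) (hp : 0 < p)
    (hM : 2 ≤ M) (hMp : 2 ^ d ≤ M * p) :
    ∑ l : Fin d → Fin k₀, (1 + ∑ i, yy M (l i)) ^ (-(p + d)) ≤ Real.exp (1 / 2) := by
  have hd0 : (0 : ℝ) < d := by exact_mod_cast hd
  apply aux_lattice d k₀ hd M (p + d) (1 / 2) hM (by positivity) _ hk₀
  have hMpos : 0 < M := by linarith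
  have h1 := aux_sum1 (d * M) (p / d) (by positivity) (by positivity) (k₀ - 1)
  have h2 : 0 ≤ (1 + (d * M) * ((k₀ - 1 : ℕ) : ℝ)) ^ (-(p / d)) :=
    Real.rpow_nonneg (by positivity) _
  have e : p / d * (d * M) = M * p := by field_simp
  rw [e] at h1
  have h3 : ∑ l ∈ Finset.range (k₀ - 1), (1 + d * yy M (l + 1)) ^ (-((p + d) / d)) ≤
      ∑ l ∈ Finset.range (k₀ - 1), (1 + (d * M) * ((l : ℝ) + 1)) ^ (-(1 + p / d)) := by
    apply Finset.sum_le_sum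
    intro l _
    have e : (p + d) / d = 1 + p / d := by field_simp; ring
    rw [e]
    apply Real.rpow_le_rpow_of_nonpos (by positivity)
    · have := mul_le_mul_of_nonneg_left (yy_ge M hM (l + 1)) hd0.le
      push_cast at this
      linarith
    · have : 0 < p / d := by positivity
      linarith
  refine h3.trans ?_
  set S := ∑ l ∈ Finset.range (k₀ - 1), (1 + (d * M) * ((l : ℝ) + 1)) ^ (-(1 + p / d))
  have hS : 0 ≤ S := Finset.sum_nonneg fun l _ => Real.rpow_nonneg (by positivity) _
  have h4 : (2 : ℝ) * d ≤ 2 ^ d := by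
    have h5 : ∀ d : ℕ, 1 ≤ d → 2 * d ≤ 2 ^ d := by
      intro d hd
      induction d, hd using Nat.le_induction with
      | base => norm_num
      | succ n hn ih => rw [pow_succ]; omega
    exact_mod_cast h5 d hd
  have h6 : 2 * d * S ≤ 1 := by nlinarith
  rw [le_div_iff₀ hd0]; linarith

theorem aux_B (d k₀ : ℕ) (hd : 1 ≤ d) (hk₀ : 3 ≤ k₀) (M : ℝ)
    (hM : 2 ≤ M) (hlog : Real.log (Real.log k₀) ≤ M) :
    ∑ l : Fin d → Fin k₀, (1 + ∑ i, yy M (l i)) ^ (-(d : ℝ)) ≤ Real.exp (1.7) := by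
  have hd0 : (0 : ℝ) < d := by exact_mod_cast hd
  have hMpos : 0 < M := by linarith
  apply aux_lattice d k₀ hd M d 1.7 hM hd0.le _ hk₀
  rw [div_self hd0.ne']
  have hterm : ∀ l : ℕ, (1 + d * yy M (l + 1)) ^ (-(1 : ℝ)) ≤
      (d * M)⁻¹ * (((l : ℝ) + 1) * (1 + Real.log ((l : ℝ) + 2)))⁻¹ := by
    intro l
    have hB : 0 ≤ Real.log ((l : ℝ) + 2) :=
      Real.log_nonneg (by have : (0:ℝ) ≤ l := Nat.cast_nonneg l; linarith)
    rw [Real.rpow_neg_one, ← mul_inv]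
    apply inv_anti₀ (by positivity)
    have e : yy M (l + 1) = ((l : ℝ) + 1) * M * (1 + Real.log ((l : ℝ) + 2)) := by
      unfold yy; push_cast; rw [show (l : ℝ) + 1 + 1 = l + 2 by ring]
    rw [e]
    have : d * M * (((l : ℝ) + 1) * (1 + Real.log ((l : ℝ) + 2))) =
      d * (((l : ℝ) + 1) * M * (1 + Real.log ((l : ℝ) + 2))) := by ring
    linarith
  refine (Finset.sum_le_sum fun l _ => hterm l).trans ?_
  rw [← Finset.mul_sum]
  obtain ⟨n, rfl⟩ : ∃ n, k₀ = n + 2 := ⟨k₀ - 2, by omega⟩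
  rw [show n + 2 - 1 = n + 1 by omega, Finset.sum_range_succ']
  have hn0 : (1 : ℝ) ≤ n := by exact_mod_cast (show 1 ≤ n by omega)
  have h1 : ∑ l ∈ Finset.range n,
      ((((l + 1 : ℕ) : ℝ) + 1) * (1 + Real.log (((l + 1 : ℕ) : ℝ) + 2)))⁻¹ ≤
      Real.log (1 + Real.log ((n : ℝ) + 1)) := by
    refine le_trans (Finset.sum_le_sum fun l _ => ?_) (aux_sum2 n)
    have hl : (0:ℝ) ≤ l := Nat.cast_nonneg l
    have hB : 0 ≤ Real.log ((l : ℝ) + 2) := Real.log_nonneg (by linarith)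
    have hC : Real.log ((l : ℝ) + 2) ≤ Real.log ((l : ℝ) + 1 + 2) :=
      Real.log_le_log (by linarith) (by linarith)
    apply inv_anti₀ (by positivity)
    push_cast
    rw [show (l : ℝ) + 1 + 1 = l + 2 by ring]
    gcongr
  have hlk : 1 ≤ Real.log (((n + 2 : ℕ) : ℝ)) := by
    rw [Real.le_log_iff_exp_le (by positivity)]
    have := Real.exp_one_lt_d9
    push_cast
    linarith
  have h2 : Real.log (1 + Real.log ((n : ℝ) + 1)) ≤ Real.log 2 + M := by
    have hA : 0 ≤ Real.log ((n : ℝ) + 1) := Real.log_nonneg (by linarith)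
    have hA2 : Real.log ((n : ℝ) + 1) ≤ Real.log (((n + 2 : ℕ) : ℝ)) :=
      Real.log_le_log (by linarith) (by push_cast; linarith)
    have : Real.log (1 + Real.log ((n : ℝ) + 1)) ≤ Real.log (2 * Real.log (((n + 2 : ℕ) : ℝ))) :=
      Real.log_le_log (by linarith) (by linarith)
    rw [Real.log_mul (by norm_num) (by linarith)] at this
    linarith
  have h3 : ((((0 : ℕ) : ℝ) + 1) * (1 + Real.log (((0 : ℕ) : ℝ) + 2)))⁻¹ ≤ 0.667 := by
    have := Real.log_two_gt_d9
    apply inv_le_of_inv_le₀ (by norm_num)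
    norm_num
    linarith
  have h4 := Real.log_two_lt_d9
  rw [mul_inv, mul_assoc, div_eq_mul_inv, mul_comm (1.7 : ℝ)]
  apply mul_le_mul_of_nonneg_left _ (by positivity)
  rw [inv_mul_le_iff₀ hMpos]
  linarith

theorem aux_exp17 : Real.exp (1.7) ≤ 6 := by
  have h : Real.exp (1.7) ^ 10 ≤ 6 ^ 10 := by
    rw [← Real.exp_nat_mul]
    rw [show ((10 : ℕ) : ℝ) * 1.7 = (17 : ℕ) * 1 by norm_num, Real.exp_nat_mul]
    refine (pow_le_pow_left₀ (Real.exp_pos _).le Real.exp_one_lt_d9.le 17).trans ?_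
    norm_num
  exact le_of_pow_le_pow_left₀ (by norm_num) (by norm_num) h

theorem aux_exp_half : Real.exp (1 / 2) < 2 := by
  have h : Real.exp (1 / 2) ^ 2 < 2 ^ 2 := by
    rw [← Real.exp_nat_mul]
    have := Real.exp_one_lt_d9
    norm_num
    linarith
  exact lt_of_pow_lt_pow_left₀ 2 (by norm_num) h

theorem stmt17 (d k₀ : ℕ) (hd : 1 ≤ d) (hk₀ : 3 ≤ k₀) (p M : ℝ) (hp : 0 < p)
    (hM : 2 ≤ M) (hMp : 2 ^ d ≤ M * p)
    (hlog : Real.log (Real.log k₀) ≤ M) :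
    1/2 < normConst d p M k₀ ∧ normConst d p M k₀ < 1 ∧
    (∑ ℓ : Fin d → Fin k₀,
        normConst d p M k₀ * rawWeight d p M k₀ ℓ *
          (Real.sqrt (∑ i, (latticeVec d M k₀ ℓ i)^2)) ^ p)
      ≤ 6 * (d : ℝ) ^ p := by
  have hd1 : (1 : ℝ) ≤ d := by exact_mod_cast hd
  have hy : ∀ l : Fin d → Fin k₀, 0 ≤ ∑ i, yy M (l i) := fun l =>
    Finset.sum_nonneg fun i _ => yy_nonneg M hM _
  have hWpos : ∀ l : Fin d → Fin k₀, 0 < rawWeight d p M k₀ l := fun l => by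
    rw [rawWeight_eq]
    exact Real.rpow_pos_of_pos (by have := hy l; linarith) _
  have hlt2 : ∑ l : Fin d → Fin k₀, rawWeight d p M k₀ l < 2 := by
    simp only [rawWeight_eq]
    exact (aux_A d k₀ hd hk₀ p M hp hM hMp).trans_lt aux_exp_half
  have hgt1 : 1 < ∑ l : Fin d → Fin k₀, rawWeight d p M k₀ l := by
    let l0 : Fin d → Fin k₀ := fun _ => ⟨0, by omega⟩
    let l1 : Fin d → Fin k₀ := fun _ => ⟨1, by omega⟩
    have hne : l1 ≠ l0 := by
      intro h
      have := congrFun h ⟨0, by omega⟩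
      simp [l0, l1] at this
    have e0 : rawWeight d p M k₀ l0 = 1 := by
      rw [rawWeight_eq]; simp [l0, yy]
    rw [← e0]
    exact Finset.single_lt_sum hne (Finset.mem_univ _) (Finset.mem_univ _) (hWpos l1)
      (fun k _ _ => (hWpos k).le)
  have hC1 : normConst d p M k₀ < 1 := inv_lt_one_of_one_lt₀ hgt1
  have hC0 : 1 / 2 < normConst d p M k₀ := by
    unfold normConst
    rw [one_div]
    exact inv_strictAnti₀ (by linarith) hlt2
  refine ⟨hC0, hC1, ?_⟩
  have hterm : ∀ l : Fin d → Fin k₀,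
      normConst d p M k₀ * rawWeight d p M k₀ l *
          (Real.sqrt (∑ i, (latticeVec d M k₀ l i)^2)) ^ p ≤
      (1 + ∑ i, yy M (l i)) ^ (-(d : ℝ)) * (d : ℝ) ^ p := by
    intro l
    have ha : ∀ i, 0 ≤ latticeVec d M k₀ l i := fun i => by
      unfold latticeVec
      rw [latticePoint_eq]
      have := yy_nonneg M hM (l i)
      linarith
    have hx := hy l
    have hsq : Real.sqrt (∑ i, (latticeVec d M k₀ l i)^2) ≤ d * (1 + ∑ i, yy M (l i)) := by
      have h1 : Real.sqrt (∑ i, (latticeVec d M k₀ l i)^2) ≤ ∑ i, latticeVec d M k₀ l i := by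
        apply Real.sqrt_le_iff.2
        exact ⟨Finset.sum_nonneg fun i _ => ha i,
          Finset.sum_sq_le_sq_sum_of_nonneg fun i _ => ha i⟩
      have h2 : ∑ i, latticeVec d M k₀ l i = d + ∑ i, yy M (l i) := by
        unfold latticeVec
        simp only [latticePoint_eq, Finset.sum_add_distrib]
        simp
      nlinarith
    have hpw := Real.rpow_le_rpow (Real.sqrt_nonneg _) hsq hp.le
    rw [Real.mul_rpow (by positivity) (by positivity)] at hpw
    calc normConst d p M k₀ * rawWeight d p M k₀ l *
          (Real.sqrt (∑ i, (latticeVec d M k₀ l i)^2)) ^ p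
        ≤ 1 * rawWeight d p M k₀ l * ((d : ℝ) ^ p * (1 + ∑ i, yy M (l i)) ^ p) := by
          have := (hWpos l).le
          gcongr
      _ = _ := by
          rw [rawWeight_eq, one_mul, mul_left_comm, ← Real.rpow_add (by positivity), mul_comm]
          congr 2
          ring
  refine (Finset.sum_le_sum fun l _ => hterm l).trans ?_
  rw [← Finset.sum_mul]
  apply mul_le_mul_of_nonneg_right _ (by positivity)
  exact (aux_B d k₀ hd hk₀ M hM hlog).trans aux_exp17
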